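/- Let G be a finite graph on n vertices with minimum degree δ = δ(G) and girth g, and let k ≥ 2 be an integer such that 2k < g and δ(δ−1)^{k−1} > n/2 − 1 (equivalently, 2δ(δ−1)^{k−1} > n − 2). Then G admits an orientation of radius at most 4k². -/

import Mathlib

open SimpleGraph Finset

variable {V : Type*}

/-- `o` is an orientation of `G`: each edge of `G` gets exactly one direction. -/
def IsOrientation (G : SimpleGraph V) (o : V → V → Prop) : Prop :=
  (∀ x y, o x y → G.Adj x y) ∧ (∀ x y, G.Adj x y → (o x y ∨ o y x)) ∧
    (∀ x y, o x y → ¬ o y x)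

/-- There is a directed path (with respect to `o`) from `x` to `y` of length at most `n`. -/
def DPathLE (o : V → V → Prop) (n : ℕ) (x y : V) : Prop :=
  ∃ m ≤ n, ∃ f : ℕ → V, f 0 = x ∧ f m = y ∧ (∀ i < m, o (f i) (f (i + 1))) ∧
    (∀ i ≤ m, ∀ j ≤ m, f i = f j → i = j)

/-- `G` admits an orientation of radius at most `R`. -/
def OrientRadiusLE (G : SimpleGraph V) (R : ℕ) : Prop :=
  ∃ o : V → V → Prop, IsOrientation G o ∧
    ∃ u : V, ∀ v : V, DPathLE o R u v ∧ DPathLE o R v u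

/-- `G` admits an orientation of diameter at most `D`. -/
def OrientDiamLE (G : SimpleGraph V) (D : ℕ) : Prop :=
  ∃ o : V → V → Prop, IsOrientation G o ∧ ∀ x y : V, DPathLE o D x y

/-- The edge `e` lies on a cycle of `G` of length at most `n`. -/
def InCycleLE (G : SimpleGraph V) (e : Sym2 V) (n : ℕ) : Prop :=
  ∃ (v : V) (c : G.Walk v v), c.IsCycle ∧ e ∈ c.edges ∧ c.length ≤ n

/-- `G` is bridgeless: no edge is a cut edge. -/
def Bridgeless (G : SimpleGraph V) : Prop :=
  ∀ e ∈ G.edgeSet, ¬ G.IsBridge e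

/-- `c` is a rainbow `k`-edge-coloring of `G`: every two distinct vertices are joined
by a path whose edges receive pairwise distinct colors. -/
def IsRainbowColoring (G : SimpleGraph V) (k : ℕ) (c : Sym2 V → Fin k) : Prop :=
  ∀ x y : V, x ≠ y → ∃ p : G.Walk x y, p.IsPath ∧ (p.edges.map c).Nodup

/-- The rainbow connection number of `G` is at most `k`. -/
def RcLE (G : SimpleGraph V) (k : ℕ) : Prop :=
  ∃ c : Sym2 V → Fin k, IsRainbowColoring G k c


/-! ### Counting vertices near an edge -/

/-- Two short paths between the same endpoints coincide in a graph of large girth. -/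
theorem short_path_unique (G : SimpleGraph V) (k : ℕ) (hg : 2 * (k : ℕ∞) < G.egirth)
    {a b : V} (p q : G.Walk a b) (hp : p.IsPath) (hq : q.IsPath)
    (hl : p.length + q.length ≤ 2 * k) : p = q := by
  classical
  set K : SimpleGraph V := SimpleGraph.fromEdgeSet {e | e ∈ p.edges ∨ e ∈ q.edges} with hK
  have hKe : ∀ e, e ∈ K.edgeSet → e ∈ p.edges ∨ e ∈ q.edges := by
    intro e he
    rw [hK, SimpleGraph.edgeSet_fromEdgeSet] at he
    exact he.1
  have hpK : ∀ e ∈ p.edges, e ∈ K.edgeSet := by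
    intro e he
    rw [hK, SimpleGraph.edgeSet_fromEdgeSet]
    exact ⟨Or.inl he, G.not_isDiag_of_mem_edgeSet (p.edges_subset_edgeSet he)⟩
  have hqK : ∀ e ∈ q.edges, e ∈ K.edgeSet := by
    intro e he
    rw [hK, SimpleGraph.edgeSet_fromEdgeSet]
    exact ⟨Or.inr he, G.not_isDiag_of_mem_edgeSet (q.edges_subset_edgeSet he)⟩
  have hKG : ∀ e ∈ K.edgeSet, e ∈ G.edgeSet := by
    intro e he
    rcases hKe e he with h | h
    · exact p.edges_subset_edgeSet h
    · exact q.edges_subset_edgeSet h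
  have hac : K.IsAcyclic := by
    intro v c hc
    have hc' := hc.transfer (q := c) (H := G)
      (fun e he => hKG e (c.edges_subset_edgeSet he))
    have h1 := SimpleGraph.egirth_le_length hc'
    rw [SimpleGraph.Walk.length_transfer] at h1
    have h2 : c.length ≤ 2 * k := by
      have h3 : c.edges.toFinset ⊆ (p.edges ++ q.edges).toFinset := by
        intro e he
        rw [List.mem_toFinset] at he ⊢
        rw [List.mem_append]
        exact hKe e (c.edges_subset_edgeSet he)
      have h4 := Finset.card_le_card h3
      rw [List.toFinset_card_of_nodup hc.edges_nodup] at h4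
      have h5 := List.toFinset_card_le (p.edges ++ q.edges)
      simp only [List.length_append, SimpleGraph.Walk.length_edges] at h4 h5
      omega
    have h6 : (c.length : ℕ∞) ≤ 2 * (k : ℕ∞) := by exact_mod_cast h2
    exact absurd (hg.trans_le (h1.trans h6)) (lt_irrefl _)
  have := (hac.subsingleton_path a b).elim ⟨_, hp.transfer hpK⟩ ⟨_, hq.transfer hqK⟩
  have h := congrArg (fun r : K.Path a b => r.1.support) this
  simp only [SimpleGraph.Walk.support_transfer] at h
  exact SimpleGraph.Walk.ext_support h

/-- Vertices reached from `x` by a path of length `i` avoiding `y`. -/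
def layerSet (G : SimpleGraph V) (x y : V) (i : ℕ) : Set V :=
  {z | ∃ p : G.Walk x z, p.IsPath ∧ y ∉ p.support ∧ p.length = i}

theorem layerSet_succ_card [Fintype V] (G : SimpleGraph V) [DecidableRel G.Adj] (k : ℕ)
    (hk : 2 ≤ k) (hg : 2 * (k : ℕ∞) < G.egirth) {x y : V} (hxy : G.Adj x y) (i : ℕ)
    (hi : i + 1 ≤ k) :
    (G.minDegree - 1) * (layerSet G x y i).ncard ≤ (layerSet G x y (i + 1)).ncard := by
  classical
  have key : ∀ z : V, ∃ B : Finset V, z ∈ layerSet G x y i → (G.minDegree - 1 ≤ B.card ∧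
      ∀ w ∈ B, ∃ (p : G.Walk x z) (h : G.Adj z w), p.length = i ∧ (p.concat h).IsPath ∧
        y ∉ (p.concat h).support) := by
    intro z
    by_cases hz : z ∈ layerSet G x y i
    swap
    · exact ⟨∅, fun h => absurd h hz⟩
    obtain ⟨p, hp, hy, hl⟩ := hz
    have hP : (SimpleGraph.Walk.cons hxy.symm p).IsPath := hp.cons hy
    refine ⟨(G.neighborFinset z).erase (SimpleGraph.Walk.cons hxy.symm p).penultimate,
      fun _ => ⟨?_, ?_⟩⟩
    · have h1 := Finset.pred_card_le_card_erase (s := G.neighborFinset z)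
        (a := (SimpleGraph.Walk.cons hxy.symm p).penultimate)
      have h2 := G.minDegree_le_degree z
      rw [SimpleGraph.card_neighborFinset_eq_degree] at h1
      omega
    · intro w hw
      rw [Finset.mem_erase, SimpleGraph.mem_neighborFinset] at hw
      obtain ⟨hw1, hw2⟩ := hw
      have hns : w ∉ (SimpleGraph.Walk.cons hxy.symm p).support := by
        intro hmem
        apply hw1
        have e1 : (SimpleGraph.Walk.cons hxy.symm p).dropUntil w hmem
            = SimpleGraph.Walk.cons hw2.symm SimpleGraph.Walk.nil := by
          apply short_path_unique G k hg _ _ (hP.dropUntil hmem)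
          · simp [hw2.ne']
          · have := SimpleGraph.Walk.length_dropUntil_le_length
              (SimpleGraph.Walk.cons hxy.symm p) hmem
            simp only [SimpleGraph.Walk.length_cons, SimpleGraph.Walk.length_nil] at this ⊢
            omega
        have e2 := SimpleGraph.Walk.take_spec (SimpleGraph.Walk.cons hxy.symm p) hmem
        rw [e1] at e2
        rw [← e2]
        change w = (SimpleGraph.Walk.concat _ hw2.symm).penultimate
        rw [SimpleGraph.Walk.penultimate_concat]
      rw [SimpleGraph.Walk.support_cons, List.mem_cons, not_or] at hns
      refine ⟨p, hw2, hl, hp.concat hns.2 hw2, ?_⟩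
      rw [SimpleGraph.Walk.support_concat]
      simp [hy, Ne.symm hns.1]
  choose B hB using key
  set T := (layerSet G x y i).toFinset with hT
  have hsub : ((T.biUnion B : Finset V) : Set V) ⊆ layerSet G x y (i + 1) := by
    intro w hw
    rw [Finset.mem_coe, Finset.mem_biUnion] at hw
    obtain ⟨z, hz, hw⟩ := hw
    obtain ⟨p, h, hl, hp, hy⟩ := (hB z (by simpa [hT] using hz)).2 w hw
    exact ⟨p.concat h, hp, hy, by rw [SimpleGraph.Walk.length_concat, hl]⟩
  have hdis : (T : Set V).PairwiseDisjoint B := by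
    intro z hz z' hz' hne
    rw [Function.onFun, Finset.disjoint_left]
    intro w hw hw'
    apply hne
    obtain ⟨p, h, hl, hp, hy⟩ := (hB z (by simpa [hT] using hz)).2 w hw
    obtain ⟨p', h', hl', hp', hy'⟩ := (hB z' (by simpa [hT] using hz')).2 w hw'
    have e := short_path_unique G k hg _ _ hp hp' (by
      rw [SimpleGraph.Walk.length_concat, SimpleGraph.Walk.length_concat]; omega)
    have e' := congrArg SimpleGraph.Walk.penultimate e
    simpa using e'
  have h1 := Set.ncard_le_ncard hsub (Set.toFinite _)
  rw [Set.ncard_coe_finset, Finset.card_biUnion hdis] at h1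
  refine le_trans ?_ h1
  have h2 : (layerSet G x y i).ncard = T.card := by
    rw [hT, Set.ncard_eq_toFinset_card']
  rw [h2, mul_comm, ← smul_eq_mul]
  exact Finset.card_nsmul_le_sum _ _ _ (fun z hz => (hB z (by simpa [hT] using hz)).1)

theorem layerSet_card [Fintype V] (G : SimpleGraph V) [DecidableRel G.Adj] (k : ℕ)
    (hk : 2 ≤ k) (hg : 2 * (k : ℕ∞) < G.egirth) {x y : V} (hxy : G.Adj x y) (i : ℕ)
    (hi : i ≤ k) :
    (G.minDegree - 1) ^ i ≤ (layerSet G x y i).ncard := by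
  induction i with
  | zero =>
    rw [pow_zero, Nat.one_le_iff_ne_zero, Ne, Set.ncard_eq_zero (Set.toFinite _)]
    intro h
    have : x ∈ layerSet G x y 0 := ⟨SimpleGraph.Walk.nil, by simp, by simp [hxy.ne'], rfl⟩
    rw [h] at this
    exact this
  | succ i ih =>
    have h1 := layerSet_succ_card G k hk hg hxy i hi
    have h2 := ih (by omega)
    calc (G.minDegree - 1) ^ (i + 1) = (G.minDegree - 1) * (G.minDegree - 1) ^ i := by ring
      _ ≤ (G.minDegree - 1) * (layerSet G x y i).ncard := Nat.mul_le_mul_left _ h2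
      _ ≤ _ := h1

theorem layerSet_disjoint (G : SimpleGraph V) (k : ℕ)
    (hg : 2 * (k : ℕ∞) < G.egirth) {x y : V} {i j : ℕ} (hij : i ≠ j)
    (hi : i ≤ k) (hj : j ≤ k) : Disjoint (layerSet G x y i) (layerSet G x y j) := by
  rw [Set.disjoint_left]
  rintro z ⟨p, hp, -, hl⟩ ⟨q, hq, -, hl'⟩
  apply hij
  have := short_path_unique G k hg p q hp hq (by omega)
  rw [← hl, ← hl', this]

/-- Vertices within distance `k` of `x` after deleting the edge `xy`. -/
def delBall (G : SimpleGraph V) (x y : V) (k : ℕ) : Set V :=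
  {z | ∃ p : (G.deleteEdges {s(x, y)}).Walk x z, p.length ≤ k}

theorem delBall_card [Fintype V] (G : SimpleGraph V) [DecidableRel G.Adj] (k : ℕ)
    (hk : 2 ≤ k) (hg : 2 * (k : ℕ∞) < G.egirth)
    (hδ : (Fintype.card V : ℤ) - 2 <
      2 * (G.minDegree * (G.minDegree - 1) ^ (k - 1) : ℕ)) {x y : V} (hxy : G.Adj x y) :
    Fintype.card V < 2 * (delBall G x y k).ncard := by
  classical
  have hsub : layerSet G x y 0 ∪ (layerSet G x y (k - 1) ∪ layerSet G x y k) ⊆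
      delBall G x y k := by
    have hh : ∀ i ≤ k, layerSet G x y i ⊆ delBall G x y k := by
      rintro i hi z ⟨p, hp, hy, hl⟩
      refine ⟨p.toDeleteEdge s(x, y) ?_, ?_⟩
      · intro h
        exact hy (p.snd_mem_support_of_mem_edges h)
      · simp [hl, hi]
    exact Set.union_subset (hh 0 (by omega)) (Set.union_subset (hh _ (by omega)) (hh k le_rfl))
  have h1 := Set.ncard_le_ncard hsub (Set.toFinite _)
  rw [Set.ncard_union_eq _ (Set.toFinite _) (Set.toFinite _),
    Set.ncard_union_eq _ (Set.toFinite _) (Set.toFinite _)] at h1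
  rotate_left
  · exact layerSet_disjoint G k hg (by omega) (by omega) le_rfl
  · rw [Set.disjoint_union_right]
    exact ⟨layerSet_disjoint G k hg (by omega) (by omega) (by omega),
      layerSet_disjoint G k hg (by omega) (by omega) (by omega)⟩
  have h2 := layerSet_card G k hk hg hxy 0 (by omega)
  have h3 := layerSet_card G k hk hg hxy (k - 1) (by omega)
  have h4 := layerSet_card G k hk hg hxy k le_rfl
  have h5 : G.minDegree * (G.minDegree - 1) ^ (k - 1) ≤
      (G.minDegree - 1) ^ (k - 1) + (G.minDegree - 1) ^ k := by
    obtain ⟨m, rfl⟩ : ∃ m, k = m + 1 := ⟨k - 1, by omega⟩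
    simp only [Nat.add_sub_cancel]
    rw [pow_succ]
    rcases Nat.eq_zero_or_pos G.minDegree with h | h
    · rw [h]; simp
    · obtain ⟨d, hd⟩ : ∃ d, G.minDegree = d + 1 := ⟨G.minDegree - 1, by omega⟩
      rw [hd]
      simp only [Nat.add_sub_cancel]
      apply le_of_eq; ring
  rw [pow_zero] at h2
  omega

theorem exists_common_of_card [Fintype V] (A B : Set V) (hA : Fintype.card V < 2 * A.ncard)
    (hB : Fintype.card V < 2 * B.ncard) : ∃ z, z ∈ A ∧ z ∈ B := by
  by_contra h
  push Not at h
  have hd : Disjoint A B := Set.disjoint_left.2 h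
  have h1 := Set.ncard_union_eq hd (Set.toFinite _) (Set.toFinite _)
  have h2 := Set.ncard_le_ncard (Set.subset_univ (A ∪ B)) (Set.toFinite _)
  rw [Set.ncard_univ, Nat.card_eq_fintype_card] at h2
  omega

theorem exists_return_walk [Fintype V] (G : SimpleGraph V) [DecidableRel G.Adj] (k : ℕ)
    (hk : 2 ≤ k) (hg : 2 * (k : ℕ∞) < G.egirth)
    (hδ : (Fintype.card V : ℤ) - 2 <
      2 * (G.minDegree * (G.minDegree - 1) ^ (k - 1) : ℕ)) {x y : V} (hxy : G.Adj x y) :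
    ∃ p : (G.deleteEdges {s(x, y)}).Walk y x, p.length ≤ 2 * k := by
  obtain ⟨z, ⟨p, hp⟩, hz⟩ := exists_common_of_card _ _ (delBall_card G k hk hg hδ hxy)
    (delBall_card G k hk hg hδ hxy.symm)
  unfold delBall at hz
  rw [Sym2.eq_swap] at hz
  obtain ⟨q, hq⟩ := hz
  refine ⟨q.append p.reverse, ?_⟩
  rw [SimpleGraph.Walk.length_append, SimpleGraph.Walk.length_reverse]
  omega

theorem exists_short_walk [Fintype V] (G : SimpleGraph V) [DecidableRel G.Adj] (k : ℕ)
    (hk : 2 ≤ k) (hg : 2 * (k : ℕ∞) < G.egirth)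
    (hδ : (Fintype.card V : ℤ) - 2 <
      2 * (G.minDegree * (G.minDegree - 1) ^ (k - 1) : ℕ)) (u v : V) :
    ∃ p : G.Walk u v, p.length ≤ 2 * k := by
  classical
  by_cases huv : u = v
  · subst huv
    exact ⟨SimpleGraph.Walk.nil, by simp⟩
  have hc : 2 ≤ Fintype.card V := by
    have := Fintype.one_lt_card_iff.2 ⟨u, v, huv⟩
    omega
  have hpos : 0 < G.minDegree := by
    rcases Nat.eq_zero_or_pos G.minDegree with h | h
    · rw [h] at hδ
      simp at hδ
      omega
    · exact h
  have hn : ∀ a : V, ∃ b, G.Adj a b := by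
    intro a
    have := G.minDegree_le_degree a
    exact (G.degree_pos_iff_exists_adj a).1 (by omega)
  obtain ⟨u', hu⟩ := hn u
  obtain ⟨v', hv⟩ := hn v
  obtain ⟨z, ⟨p, hp⟩, ⟨q, hq⟩⟩ := exists_common_of_card _ _ (delBall_card G k hk hg hδ hu)
    (delBall_card G k hk hg hδ hv)
  refine ⟨(p.mapLe (SimpleGraph.deleteEdges_le _)).append
    (q.mapLe (SimpleGraph.deleteEdges_le _)).reverse, ?_⟩
  simp only [SimpleGraph.Walk.length_append, SimpleGraph.Walk.length_reverse,
    SimpleGraph.Walk.length_map, SimpleGraph.Walk.mapLe]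
  omega

/-! ### Directed walks -/

/-- `DWalk o n a b`: there is a directed walk of length exactly `n` from `a` to `b`. -/
def DWalk (o : V → V → Prop) : ℕ → V → V → Prop
  | 0, a, b => a = b
  | n + 1, a, b => ∃ c, o a c ∧ DWalk o n c b

theorem DWalk.trans {o : V → V → Prop} {n m : ℕ} {a b c : V} (h : DWalk o n a b)
    (h' : DWalk o m b c) : DWalk o (n + m) a c := by
  induction n generalizing a with
  | zero =>
    have : a = b := h
    subst this
    rwa [Nat.zero_add]
  | succ n ih =>
    obtain ⟨d, hd, h⟩ := h
    rw [Nat.add_right_comm]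
    exact ⟨d, hd, ih h⟩

theorem DWalk.single {o : V → V → Prop} {a b : V} (h : o a b) : DWalk o 1 a b := ⟨b, h, rfl⟩

theorem DWalk.mono {o o' : V → V → Prop} (ho : ∀ x y, o x y → o' x y) {n : ℕ} {a b : V}
    (h : DWalk o n a b) : DWalk o' n a b := by
  induction n generalizing a with
  | zero => exact h
  | succ n ih =>
    obtain ⟨d, hd, h⟩ := h
    exact ⟨d, ho _ _ hd, ih h⟩

theorem DWalk.flip {o : V → V → Prop} {n : ℕ} {a b : V}
    (h : DWalk o n a b) : DWalk (fun x y => o y x) n b a := by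
  induction n generalizing a with
  | zero => exact Eq.symm h
  | succ n ih =>
    obtain ⟨d, hd, h⟩ := h
    exact (ih h).trans (DWalk.single (o := fun x y => o y x) hd)

theorem DWalk.of_fun {o : V → V → Prop} (f : ℕ → V) (n i : ℕ)
    (h : ∀ j, i ≤ j → j < i + n → o (f j) (f (j + 1))) : DWalk o n (f i) (f (i + n)) := by
  induction n generalizing i with
  | zero => exact rfl
  | succ n ih =>
    refine ⟨f (i + 1), h i le_rfl (by omega), ?_⟩
    have := ih (i + 1) (fun j h1 h2 => h j (by omega) (by omega))
    rwa [Nat.add_right_comm, Nat.add_assoc] at this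

theorem DWalk.exists_fun {o : V → V → Prop} {n : ℕ} {a b : V}
    (h : DWalk o n a b) : ∃ f : ℕ → V, f 0 = a ∧ f n = b ∧ ∀ i < n, o (f i) (f (i + 1)) := by
  induction n generalizing a with
  | zero => exact ⟨fun _ => a, rfl, h, by simp⟩
  | succ n ih =>
    obtain ⟨d, hd, h⟩ := h
    obtain ⟨f, h0, hn, hf⟩ := ih h
    refine ⟨fun i => Nat.casesOn i a f, rfl, hn, ?_⟩
    intro i hi
    cases i with
    | zero =>
      change o a (f 0)
      rwa [h0]
    | succ i => exact hf i (by omega)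

theorem DWalk.dPathLE {o : V → V → Prop} {n N : ℕ} {a b : V}
    (h : DWalk o n a b) (hn : n ≤ N) : DPathLE o N a b := by
  classical
  have hex : ∃ n, DWalk o n a b := ⟨n, h⟩
  obtain ⟨f, h0, hm, hf⟩ := (Nat.find_spec hex).exists_fun
  set m := Nat.find hex with hmdef
  have key : ∀ i j, i < j → j ≤ m → f i ≠ f j := by
    intro i j hij hj he
    have w1 : DWalk o i (f 0) (f (0 + i)) :=
      DWalk.of_fun f i 0 (fun l _ h2 => hf l (by omega))
    have w2 : DWalk o (m - j) (f j) (f (j + (m - j))) :=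
      DWalk.of_fun f (m - j) j (fun l _ h2 => hf l (by omega))
    rw [Nat.zero_add, he, h0] at w1
    rw [Nat.add_sub_cancel' hj, hm] at w2
    have := Nat.find_min' hex (w1.trans w2)
    omega
  refine ⟨m, (Nat.find_min' hex h).trans hn, f, h0, hm, hf, ?_⟩
  intro i hi j hj he
  rcases lt_trichotomy i j with hlt | heq | hlt
  · exact absurd he (key i j hlt hj)
  · exact heq
  · exact absurd he.symm (key j i hlt hi)

theorem DWalk.of_walk {G : SimpleGraph V} {o : V → V → Prop} {a b : V} (p : G.Walk a b)
    (h : ∀ d ∈ p.darts, o d.fst d.snd) : DWalk o p.length a b := by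
  induction p with
  | nil => exact rfl
  | @cons u v w hadj p ih =>
    simp only [SimpleGraph.Walk.darts_cons, List.mem_cons, forall_eq_or_imp] at h
    exact ⟨v, h.1, ih h.2⟩

/-! ### Adding ears -/

/-- `o` is a partial orientation of `G` with all arcs inside `S`. -/
def POr (G : SimpleGraph V) (S : Set V) (o : V → V → Prop) : Prop :=
  (∀ x y, o x y → G.Adj x y ∧ x ∈ S ∧ y ∈ S) ∧ (∀ x y, o x y → ¬ o y x)

/-- `z` lies on a short directed ear with ends in `H`. -/
def GoodV (G : SimpleGraph V) (H : Set V) (η : ℕ) (o : V → V → Prop) (z : V) : Prop :=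
  ∃ a b, a + b ≤ η ∧ (∃ h ∈ H, DWalk o a h z) ∧ (∃ h ∈ H, DWalk o b z h) ∧
    ∀ h ∈ H, ∀ U : G.Walk z h, a ≤ U.length ∨ b ≤ U.length

/-- Invariant of the ear-adding procedure. -/
def EInv (G : SimpleGraph V) (H : Set V) (η : ℕ) (o₀ : V → V → Prop) (S : Set V)
    (o : V → V → Prop) : Prop :=
  H ⊆ S ∧ (∀ x y, o₀ x y → o x y) ∧ POr G S o ∧ ∀ z ∈ S, GoodV G H η o z

theorem EInv.flip {G : SimpleGraph V} {H : Set V} {η : ℕ} {o₀ : V → V → Prop} {S : Set V}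
    {o : V → V → Prop} (h : EInv G H η o₀ S o) :
    EInv G H η (fun x y => o₀ y x) S (fun x y => o y x) := by
  obtain ⟨h1, h2, ⟨h3, h4⟩, h5⟩ := h
  refine ⟨h1, fun x y => h2 y x, ⟨fun x y hxy => ?_, fun x y => h4 y x⟩, fun z hz => ?_⟩
  · obtain ⟨a, b, c⟩ := h3 y x hxy
    exact ⟨a.symm, c, b⟩
  · obtain ⟨a, b, hab, ⟨h, hh, w⟩, ⟨h', hh', w'⟩, hU⟩ := h5 z hz
    exact ⟨b, a, by omega, ⟨h', hh', w'.flip⟩, ⟨h, hh, w.flip⟩, fun t ht U => (hU t ht U).symm⟩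

theorem trail_darts_asymm {G : SimpleGraph V} {a b : V} {p : G.Walk a b} (hp : p.IsTrail)
    {d d' : G.Dart} (hd : d ∈ p.darts) (hd' : d' ∈ p.darts) (h1 : d.fst = d'.snd)
    (h2 : d.snd = d'.fst) : False := by
  have hn := hp.edges_nodup
  unfold SimpleGraph.Walk.edges at hn
  have he : d.edge = d'.edge := by
    rw [SimpleGraph.dart_edge_eq_iff]
    right
    ext
    · exact h1
    · exact h2
  have := List.inj_on_of_nodup_map hn hd hd' he
  subst this
  exact d.adj.ne h1

theorem ear_step_fwd {G : SimpleGraph V} {H : Set V} {η : ℕ} {o₀ : V → V → Prop} {S : Set V}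
    {o : V → V → Prop} (hI : EInv G H η o₀ S o) {x y v z h : V} (hx : x ∈ H)
    (hxy : G.Adj x y)
    (w : (G.deleteEdges {s(x, y)}).Walk y v) (hvz : (G.deleteEdges {s(x, y)}).Adj v z)
    (hP : (w.concat hvz).IsTrail) (hwS : ∀ t ∈ w.support, t ∉ S) (hz : z ∈ S) (b : ℕ)
    (hh : h ∈ H) (hb : DWalk o b z h) (hlen : w.length + 2 + b ≤ η)
    (hmin : ∀ (t : V) (p : (G.deleteEdges {s(x, y)}).Walk y t)
      (q : (G.deleteEdges {s(x, y)}).Walk t v), p.append q = w →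
      ∀ h ∈ H, ∀ U : G.Walk t h, p.length + 1 ≤ U.length ∨ q.length + 1 + b ≤ U.length) :
    ∃ S' o', EInv G H η o₀ S' o' ∧ S ⊆ S' ∧ y ∈ S' := by
  classical
  obtain ⟨hHS, hoo, ⟨hP1, hP2⟩, hgood⟩ := hI
  set o' : V → V → Prop := fun u t => o u t ∨ (u = x ∧ t = y) ∨
    ∃ d ∈ (w.concat hvz).darts, d.fst = u ∧ d.snd = t with ho'
  have hle : ∀ u t, o u t → o' u t := fun u t h => Or.inl h
  have hfst : ∀ d ∈ (w.concat hvz).darts, d.fst ∈ w.support := by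
    intro d hd
    rw [SimpleGraph.Walk.darts_concat, List.concat_eq_append, List.mem_append] at hd
    rcases hd with hd | hd
    · exact w.dart_fst_mem_support_of_mem_darts hd
    · simp only [List.mem_singleton] at hd
      subst hd
      exact w.end_mem_support
  have hsnd : ∀ d ∈ (w.concat hvz).darts, d.snd ∈ w.support ∨ d.snd = z := by
    intro d hd
    rw [SimpleGraph.Walk.darts_concat, List.concat_eq_append, List.mem_append] at hd
    rcases hd with hd | hd
    · exact Or.inl (w.dart_snd_mem_support_of_mem_darts hd)
    · simp only [List.mem_singleton] at hd
      subst hd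
      exact Or.inr rfl
  have hyw : y ∈ w.support := w.start_mem_support
  refine ⟨S ∪ {t | t ∈ w.support}, o', ⟨?_, ?_, ⟨?_, ?_⟩, ?_⟩, Set.subset_union_left,
    Or.inr hyw⟩
  · exact hHS.trans Set.subset_union_left
  · exact fun u t h => hle u t (hoo u t h)
  · rintro u t (h | ⟨rfl, rfl⟩ | ⟨d, hd, rfl, rfl⟩)
    · obtain ⟨h1, h2, h3⟩ := hP1 u t h
      exact ⟨h1, Or.inl h2, Or.inl h3⟩
    · exact ⟨hxy, Or.inl (hHS hx), Or.inr hyw⟩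
    · refine ⟨SimpleGraph.deleteEdges_le _ d.adj, Or.inr (hfst d hd), ?_⟩
      rcases hsnd d hd with h | h
      · exact Or.inr h
      · rw [h]; exact Or.inl hz
  · have hnoxy : ∀ d : (G.deleteEdges {s(x, y)}).Dart, ¬ (d.fst = y ∧ d.snd = x) := by
      rintro d ⟨h1, h2⟩
      have := d.adj
      rw [SimpleGraph.deleteEdges_adj, h1, h2] at this
      exact this.2 (by rw [Set.mem_singleton_iff, Sym2.eq_swap])
    rintro u t (h | ⟨rfl, rfl⟩ | ⟨d, hd, rfl, rfl⟩) (h' | ⟨h1, h2⟩ | ⟨d', hd', h1, h2⟩)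
    · exact hP2 u t h h'
    · exact hwS y hyw (by simpa [h1, h2] using (hP1 u t h).2.1)
    · exact hwS _ (hfst d' hd') (h1 ▸ (hP1 u t h).2.2)
    · exact hwS _ hyw (hP1 _ _ h').2.1
    · exact hxy.ne h2
    · exact hnoxy d' ⟨h1, h2⟩
    · exact hwS _ (hfst d hd) (hP1 _ _ h').2.2
    · exact hnoxy d ⟨h2, h1⟩
    · exact trail_darts_asymm hP hd hd' h2.symm h1.symm
  · intro t ht
    by_cases htS : t ∈ S
    · obtain ⟨a, b, hab, ⟨h, hh, w⟩, ⟨h', hh', w'⟩, hU⟩ := hgood t htS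
      exact ⟨a, b, hab, ⟨h, hh, w.mono hle⟩, ⟨h', hh', w'.mono hle⟩, hU⟩
    have htw : t ∈ w.support := ht.resolve_left htS
    have hsp := w.take_spec htw
    have hlsum : (w.takeUntil t htw).length + (w.dropUntil t htw).length = w.length := by
      rw [← SimpleGraph.Walk.length_append, hsp]
    have hdw : ∀ d ∈ w.darts, o' d.fst d.snd := by
      intro d hd
      refine Or.inr (Or.inr ⟨d, ?_, rfl, rfl⟩)
      rw [SimpleGraph.Walk.darts_concat, List.concat_eq_append, List.mem_append]
      exact Or.inl hd
    have hvz' : o' v z := by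
      refine Or.inr (Or.inr ⟨⟨(v, z), hvz⟩, ?_, rfl, rfl⟩)
      rw [SimpleGraph.Walk.darts_concat, List.concat_eq_append, List.mem_append]
      exact Or.inr (by simp)
    refine ⟨(w.takeUntil t htw).length + 1, (w.dropUntil t htw).length + 1 + b, by omega,
      ⟨x, hx, ?_⟩, ⟨h, hh, ?_⟩, hmin t _ _ hsp⟩
    · exact ⟨y, Or.inr (Or.inl ⟨rfl, rfl⟩), DWalk.of_walk _ (fun d hd =>
        hdw d (w.darts_takeUntil_subset_darts htw hd))⟩
    · exact ((DWalk.of_walk _ (fun d hd =>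
        hdw d (w.darts_dropUntil_subset_darts htw hd))).trans (DWalk.single hvz')).trans
        (hb.mono hle)

theorem walk_first_hit {G : SimpleGraph V} (S : Set V) {y h : V} (W : G.Walk y h)
    (hy : y ∉ S) (hh : h ∈ S) : ∃ (v z : V) (w : G.Walk y v) (hvz : G.Adj v z)
      (tail : G.Walk z h), W = (w.concat hvz).append tail ∧ z ∈ S ∧
      ∀ t ∈ w.support, t ∉ S := by
  induction W with
  | nil => exact absurd hh hy
  | @cons a b c hab W ih =>
    by_cases hb : b ∈ S
    · exact ⟨a, b, SimpleGraph.Walk.nil, hab, W, rfl, hb, by simpa using hy⟩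
    · obtain ⟨v, z, w, hvz, tail, hW, hz, hw⟩ := ih hb hh
      refine ⟨v, z, SimpleGraph.Walk.cons hab w, hvz, tail, ?_, hz, ?_⟩
      · rw [hW]; rfl
      · intro t ht
        rw [SimpleGraph.Walk.support_cons, List.mem_cons] at ht
        rcases ht with rfl | ht
        · exact hy
        · exact hw t ht

theorem walk_avoid_edge {G : SimpleGraph V} (H : Set V) {x y : V} (hx : x ∈ H) {t h : V}
    (U : G.Walk t h) (hh : h ∈ H) :
    (∃ h' ∈ H, ∃ U' : (G.deleteEdges {s(x, y)}).Walk t h', U'.length ≤ U.length) ∨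
    (∃ U' : (G.deleteEdges {s(x, y)}).Walk t y, U'.length + 1 ≤ U.length) := by
  induction U with
  | nil => exact Or.inl ⟨_, hh, SimpleGraph.Walk.nil, le_rfl⟩
  | @cons a b c hab U ih =>
    by_cases he : s(a, b) = s(x, y)
    · rw [Sym2.eq_iff] at he
      rcases he with ⟨rfl, rfl⟩ | ⟨rfl, rfl⟩
      · exact Or.inl ⟨a, hx, SimpleGraph.Walk.nil, by simp⟩
      · exact Or.inr ⟨SimpleGraph.Walk.nil, by simp⟩
    · have hab' : (G.deleteEdges {s(x, y)}).Adj a b := by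
        rw [SimpleGraph.deleteEdges_adj]
        exact ⟨hab, he⟩
      rcases ih hh with ⟨h', hh', U', hU⟩ | ⟨U', hU⟩
      · exact Or.inl ⟨h', hh', SimpleGraph.Walk.cons hab' U', by simpa using hU⟩
      · exact Or.inr ⟨SimpleGraph.Walk.cons hab' U', by simpa using hU⟩

theorem ear_step {G : SimpleGraph V} {H : Set V} {m : ℕ} {o₀ : V → V → Prop} {S : Set V}
    {o : V → V → Prop} (hI : EInv G H (m + 1) o₀ S o) {x y : V} (hx : x ∈ H)
    (hxy : G.Adj x y) (hy : y ∉ S)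
    (hret : ∃ p : (G.deleteEdges {s(x, y)}).Walk y x, p.length ≤ m) :
    ∃ S' o', EInv G H (m + 1) o₀ S' o' ∧ S ⊆ S' ∧ y ∈ S' := by
  classical
  obtain ⟨p₀, hp₀⟩ := hret
  have hex : ∃ n, ∃ h ∈ H, ∃ W : (G.deleteEdges {s(x, y)}).Walk y h, W.length = n :=
    ⟨_, x, hx, p₀, rfl⟩
  obtain ⟨h, hh, W, hW⟩ := Nat.find_spec hex
  have hWmin : ∀ h' ∈ H, ∀ W' : (G.deleteEdges {s(x, y)}).Walk y h',
      W.length ≤ W'.length := by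
    intro h' hh' W'
    rw [hW]
    exact Nat.find_min' hex ⟨h', hh', W', rfl⟩
  have hWm : W.length ≤ m := (hWmin x hx p₀).trans hp₀
  have hWpath : W.IsPath := by
    apply SimpleGraph.Walk.isPath_of_length_eq_dist
    apply le_antisymm _ (SimpleGraph.dist_le W)
    obtain ⟨W', hW'⟩ := W.reachable.exists_walk_length_eq_dist
    rw [← hW']
    exact hWmin h hh W'
  obtain ⟨v, z, w, hvz, tail, hWe, hz, hw⟩ := walk_first_hit S W hy (hI.1 hh)
  have hP : (w.concat hvz).IsTrail := by
    rw [hWe] at hWpath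
    exact hWpath.of_append_left.isTrail
  have hWl : W.length = w.length + 1 + tail.length := by
    rw [hWe, SimpleGraph.Walk.length_append, SimpleGraph.Walk.length_concat]
  have hmin : ∀ b ≤ tail.length, ∀ (t : V) (p : (G.deleteEdges {s(x, y)}).Walk y t)
      (q : (G.deleteEdges {s(x, y)}).Walk t v), p.append q = w →
      ∀ h ∈ H, ∀ U : G.Walk t h, p.length + 1 ≤ U.length ∨ q.length + 1 + b ≤ U.length := by
    intro b hb t p q hpq h₁ hh₁ U
    have hpq' : p.length + q.length = w.length := by
      rw [← hpq, SimpleGraph.Walk.length_append]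
    rcases walk_avoid_edge (y := y) H hx U hh₁ with ⟨h', hh', U', hU⟩ | ⟨U', hU⟩
    · right
      have := hWmin h' hh' (p.append U')
      rw [SimpleGraph.Walk.length_append] at this
      omega
    · left
      have := hWmin h hh (U'.reverse.append ((q.concat hvz).append tail))
      simp only [SimpleGraph.Walk.length_append, SimpleGraph.Walk.length_concat,
        SimpleGraph.Walk.length_reverse] at this
      omega
  obtain ⟨a, b, hab, ⟨h1, hh1, w1⟩, ⟨h2, hh2, w2⟩, hU⟩ := hI.2.2.2 z hz
  have hU' := hU h hh (tail.mapLe (SimpleGraph.deleteEdges_le _))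
  simp only [SimpleGraph.Walk.mapLe, SimpleGraph.Walk.length_map] at hU'
  rcases hU' with hU' | hU'
  · obtain ⟨S', o', hI', hS', hy'⟩ := ear_step_fwd hI.flip hx hxy w hvz hP hw hz a hh1 w1.flip
      (by omega) (hmin a hU')
    exact ⟨S', _, hI'.flip, hS', hy'⟩
  · exact ear_step_fwd hI hx hxy w hvz hP hw hz b hh2 w2 (by omega) (hmin b hU')

theorem level_step [Finite V] {G : SimpleGraph V} {H : Set V} {m : ℕ} {o₀ : V → V → Prop}
    (hret : ∀ x y, G.Adj x y → ∃ p : (G.deleteEdges {s(x, y)}).Walk y x, p.length ≤ m)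
    (n : ℕ) (S : Set V) (o : V → V → Prop) (hI : EInv G H (m + 1) o₀ S o)
    (hn : (Sᶜ).ncard ≤ n) :
    ∃ S' o', EInv G H (m + 1) o₀ S' o' ∧ ∀ x ∈ H, ∀ y, G.Adj x y → y ∈ S' := by
  induction n generalizing S o with
  | zero =>
    refine ⟨S, o, hI, fun x _ y _ => ?_⟩
    have := (Set.ncard_eq_zero (Set.toFinite _)).1 (Nat.le_zero.1 hn)
    rw [Set.compl_empty_iff] at this
    rw [this]; trivial
  | succ n ih =>
    by_cases hall : ∀ x ∈ H, ∀ y, G.Adj x y → y ∈ S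
    · exact ⟨S, o, hI, hall⟩
    · push Not at hall
      obtain ⟨x, hx, y, hxy, hy⟩ := hall
      obtain ⟨S', o', hI', hSS, hy'⟩ := ear_step hI hx hxy hy (hret x y hxy)
      refine ih S' o' hI' ?_
      have : (S'ᶜ).ncard < (Sᶜ).ncard := by
        apply Set.ncard_lt_ncard _ (Set.toFinite _)
        refine ⟨Set.compl_subset_compl.2 hSS, fun hc => ?_⟩
        exact hc hy hy'
      omega

theorem levels [Finite V] {G : SimpleGraph V} {m : ℕ}
    (hret : ∀ x y, G.Adj x y → ∃ p : (G.deleteEdges {s(x, y)}).Walk y x, p.length ≤ m)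
    (u : V) (i : ℕ) : ∃ (S : Set V) (o : V → V → Prop), POr G S o ∧
      (∀ v (p : G.Walk v u), p.length ≤ i → v ∈ S) ∧
      ∀ v ∈ S, (∃ a ≤ i * m, DWalk o a u v) ∧ (∃ b ≤ i * m, DWalk o b v u) := by
  induction i with
  | zero =>
    refine ⟨{u}, fun _ _ => False, ⟨fun _ _ h => h.elim, fun _ _ h => h.elim⟩, ?_, ?_⟩
    · intro v p hp
      exact SimpleGraph.Walk.eq_of_length_eq_zero (Nat.le_zero.1 hp)
    · rintro v rfl
      exact ⟨⟨0, by simp, rfl⟩, ⟨0, by simp, rfl⟩⟩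
  | succ i ih =>
    obtain ⟨H, o₀, hPor, hball, hdist⟩ := ih
    have hI : EInv G H (m + 1) o₀ H o₀ := by
      refine ⟨subset_rfl, fun _ _ h => h, hPor, fun z hz => ?_⟩
      exact ⟨0, 0, by omega, ⟨z, hz, rfl⟩, ⟨z, hz, rfl⟩, fun _ _ _ => Or.inl (Nat.zero_le _)⟩
    obtain ⟨S, o, ⟨hHS, hoo, hP, hgood⟩, hN⟩ := level_step hret _ H o₀ hI le_rfl
    refine ⟨S, o, hP, ?_, ?_⟩
    · intro v p hp
      cases p with
      | nil => exact hHS (hball _ SimpleGraph.Walk.nil (by simp))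
      | @cons _ c _ hvc p =>
        rw [SimpleGraph.Walk.length_cons] at hp
        exact hN c (hball c p (by omega)) v hvc.symm
    · intro v hv
      have him : (i + 1) * m = i * m + m := by ring
      by_cases hvH : v ∈ H
      · obtain ⟨⟨a, ha, wa⟩, ⟨b, hb, wb⟩⟩ := hdist v hvH
        exact ⟨⟨a, by omega, wa.mono hoo⟩, ⟨b, by omega, wb.mono hoo⟩⟩
      · obtain ⟨a, b, hab, ⟨h1, hh1, w1⟩, ⟨h2, hh2, w2⟩, -⟩ := hgood v hv
        have ha : a ≠ 0 := by
          rintro rfl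
          exact hvH ((show h1 = v from w1) ▸ hh1)
        have hb : b ≠ 0 := by
          rintro rfl
          exact hvH ((show v = h2 from w2) ▸ hh2)
        obtain ⟨⟨a', ha', wa⟩, -⟩ := hdist h1 hh1
        obtain ⟨-, ⟨b', hb', wb⟩⟩ := hdist h2 hh2
        exact ⟨⟨a' + a, by omega, (wa.mono hoo).trans w1⟩,
          ⟨b + b', by omega, w2.trans (wb.mono hoo)⟩⟩

/-- If `G` has minimum degree `δ`, girth `> 2k` (with `k ≥ 2`; the girth
being infinite for a forest), and `δ(δ-1)^{k-1} > n/2 - 1` (i.e. `2δ(δ-1)^{k-1} > n - 2`),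
then `G` admits an orientation of radius at most `4k²`. -/
theorem oriented_radius_min_degree_girth [Fintype V] [Nonempty V]
    (G : SimpleGraph V) [DecidableRel G.Adj] (k : ℕ) (hk : 2 ≤ k)
    (hgirth : 2 * (k : ℕ∞) < G.egirth)
    (hδ : (Fintype.card V : ℤ) - 2 <
      2 * (G.minDegree * (G.minDegree - 1) ^ (k - 1) : ℕ)) :
    OrientRadiusLE G (4 * k ^ 2) := by

  classical
  obtain ⟨u⟩ := ‹Nonempty V›
  obtain ⟨S, o, ⟨hP1, hP2⟩, hball, hdist⟩ := levels (G := G) (m := 2 * k)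
    (fun x y hxy => exists_return_walk G k hk hgirth hδ hxy) u (2 * k)
  have hS : ∀ v, v ∈ S := by
    intro v
    obtain ⟨p, hp⟩ := exists_short_walk G k hk hgirth hδ v u
    exact hball v p hp
  have hkk : 2 * k * (2 * k) = 4 * k ^ 2 := by ring
  let e := Fintype.equivFin V
  let o' : V → V → Prop := fun x y => o x y ∨ (G.Adj x y ∧ ¬ o y x ∧ e x < e y)
  have hle : ∀ x y, o x y → o' x y := fun _ _ h => Or.inl h
  refine ⟨o', ⟨?_, ?_, ?_⟩, u, ?_⟩
  · rintro x y (h | h)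
    · exact (hP1 x y h).1
    · exact h.1
  · intro x y hxy
    by_cases h1 : o x y
    · exact Or.inl (Or.inl h1)
    by_cases h2 : o y x
    · exact Or.inr (Or.inl h2)
    rcases lt_trichotomy (e x) (e y) with h | h | h
    · exact Or.inl (Or.inr ⟨hxy, h2, h⟩)
    · exact absurd (e.injective h) hxy.ne
    · exact Or.inr (Or.inr ⟨hxy.symm, h1, h⟩)
  · rintro x y (h | ⟨_, h1, h2⟩) (h' | ⟨_, h1', h2'⟩)
    · exact hP2 x y h h'
    · exact h1' h
    · exact h1 h'
    · exact absurd (h2.trans h2') (lt_irrefl _)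
  · intro v
    obtain ⟨⟨a, ha, wa⟩, ⟨b, hb, wb⟩⟩ := hdist v (hS v)
    exact ⟨(wa.mono hle).dPathLE (by omega), (wb.mono hle).dPathLE (by omega)⟩
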